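/- Let n ≥ 2 be an integer and i ∈ {1,2}. For every real x at which all rational functions appearing are defined, (x + γδ_{i,1}) 𝒟_i Q_{n−1}^{(i)}(x) = C_{2,n}(x) M_n(x) + D_{2,n}(x) M_{n−1}(x), where δ_{i,1} is the Kronecker delta. -/

import Mathlib

open Finset Filter Topology Polynomial

noncomputable section

/-- Pochhammer symbol `(a)_k = a(a+1)⋯(a+k−1)`. -/
def poch (a : ℝ) (k : ℕ) : ℝ := ∏ m ∈ Finset.range k, (a + m)

/-- Falling factorial `[x]_k = x(x−1)⋯(x−k+1)`. -/
def fall (x : ℝ) (k : ℕ) : ℝ := ∏ m ∈ Finset.range k, (x - m)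

/-- `⟨x⟩_i^k`: falling factorial for `i = 1`, Pochhammer symbol for `i = 2`. -/
def br (i : ℕ) (x : ℝ) (k : ℕ) : ℝ := if i = 1 then fall x k else poch x k

/-- Forward (`i = 1`) resp. backward (`i = 2`) difference operator `𝒟_i`. -/
def Dop (i : ℕ) (f : ℝ → ℝ) : ℝ → ℝ :=
  fun x => if i = 1 then f (x + 1) - f x else f x - f (x - 1)

/-- Iterated difference operator `𝒟_i^k`. -/
def Dk (i k : ℕ) (f : ℝ → ℝ) : ℝ → ℝ := (Dop i)^[k] f

/-- Kronecker delta `δ_{i,m}` (real valued). -/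
def kdelta (i m : ℕ) : ℝ := if i = m then 1 else 0

/-- The shift `x ± 1`: `x + 1` for `i = 1`, `x - 1` for `i = 2`. -/
def sh (i : ℕ) (x : ℝ) : ℝ := if i = 1 then x + 1 else x - 1

/-- Monic Meixner polynomial `M_n(x)`. -/
def MeixnerM (γ μ : ℝ) (n : ℕ) (x : ℝ) : ℝ :=
  poch γ n * (μ / (μ - 1)) ^ n *
    ∑ k ∈ Finset.range (n + 1),
      poch (-(n : ℝ)) k * poch (-x) k / poch γ k * (1 - μ⁻¹) ^ k / (Nat.factorial k : ℝ)

/-- Meixner inner product `⟨p,q⟩ = ∑_{x≥0} p(x)q(x) μ^x (γ)_x / x!`. -/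
def mIP (γ μ : ℝ) (p q : ℝ → ℝ) : ℝ :=
  ∑' x : ℕ, p x * q x * μ ^ x * poch γ x / (Nat.factorial x : ℝ)

/-- Squared Meixner norm `‖M_n‖²`. -/
def nrm2 (γ μ : ℝ) (n : ℕ) : ℝ := mIP γ μ (MeixnerM γ μ n) (MeixnerM γ μ n)

/-- Kernel `K_n^{(l,m)}(x,y)` for the operator `𝒟_i`. -/
def Klm (γ μ : ℝ) (i l m n : ℕ) (x y : ℝ) : ℝ :=
  ∑ k ∈ Finset.range (n + 1),
    Dk i l (MeixnerM γ μ k) x * Dk i m (MeixnerM γ μ k) y / nrm2 γ μ k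

/-- Sobolev inner product `⟨p,q⟩_λ = ⟨p,q⟩ + λ 𝒟_i^j p(α) 𝒟_i^j q(α)`. -/
def sIP (γ μ lam α : ℝ) (i j : ℕ) (p q : ℝ → ℝ) : ℝ :=
  mIP γ μ p q + lam * Dk i j p α * Dk i j q α

/-- `Q` is the monic Sobolev orthogonal polynomial of degree `n`. -/
def IsSobolevOP (γ μ lam α : ℝ) (i j n : ℕ) (Q : Polynomial ℝ) : Prop :=
  Q.Monic ∧ Q.natDegree = n ∧
    ∀ p : Polynomial ℝ, p.degree < (n : WithBot ℕ) →
      sIP γ μ lam α i j (fun x => Q.eval x) (fun x => p.eval x) = 0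

/-- Coefficient `a_n^{(k)}`. -/
def acoef (γ μ lam α : ℝ) (i j n k : ℕ) : ℝ :=
  -(lam * (Nat.factorial j : ℝ) * Dk i j (MeixnerM γ μ n) α * Dk i k (MeixnerM γ μ (n - 1)) α) /
    ((Nat.factorial k : ℝ) * nrm2 γ μ (n - 1) * (1 + lam * Klm γ μ i j j (n - 1) α α))

/-- Coefficient `b_n^{(k)}`. -/
def bcoef (γ μ lam α : ℝ) (i j n k : ℕ) : ℝ :=
  lam * (Nat.factorial j : ℝ) * Dk i j (MeixnerM γ μ n) α * Dk i k (MeixnerM γ μ n) α /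
    ((Nat.factorial k : ℝ) * nrm2 γ μ (n - 1) * (1 + lam * Klm γ μ i j j (n - 1) α α))

/-- Rational function `A_{1,n}(x)`. -/
def A1 (γ μ lam α : ℝ) (i j n : ℕ) (x : ℝ) : ℝ :=
  1 + (1 / br i (x - α) (j + 1)) *
    ∑ k ∈ Finset.range (j + 1), acoef γ μ lam α i j n k * br i (x - α) k

/-- Rational function `B_{1,n}(x)`. -/
def B1 (γ μ lam α : ℝ) (i j n : ℕ) (x : ℝ) : ℝ :=
  (1 / br i (x - α) (j + 1)) *
    ∑ k ∈ Finset.range (j + 1), bcoef γ μ lam α i j n k * br i (x - α) k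

/-- Meixner recurrence coefficient `α_n`. -/
def alphaR (γ μ : ℝ) (n : ℕ) : ℝ := ((n : ℝ) * (1 + μ) + μ * γ) / (1 - μ)

/-- Meixner recurrence coefficient `β_n`. -/
def betaR (γ μ : ℝ) (n : ℕ) : ℝ := (n : ℝ) * μ * ((n : ℝ) + γ - 1) / (1 - μ) ^ 2

/-- Rational function `A_{2,n}(x)`. -/
def A2 (γ μ lam α : ℝ) (i j n : ℕ) (x : ℝ) : ℝ :=
  -(B1 γ μ lam α i j (n - 1) x) / betaR γ μ (n - 1)

/-- Rational function `B_{2,n}(x)`. -/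
def B2 (γ μ lam α : ℝ) (i j n : ℕ) (x : ℝ) : ℝ :=
  A1 γ μ lam α i j (n - 1) x + A2 γ μ lam α i j n x * (alphaR γ μ (n - 1) - x)

/-- Rational function `C_{1,n}(x)`. -/
def C1 (γ μ lam α : ℝ) (i j n : ℕ) (x : ℝ) : ℝ :=
  (x + γ * kdelta i 1) * Dop i (A1 γ μ lam α i j n) x + (n : ℝ) * A1 γ μ lam α i j n (sh i x)
    - ((n : ℝ) - 1) * ((n : ℝ) + γ - 2) * μ ^ kdelta i 2 * B1 γ μ lam α i j n (sh i x) /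
        (betaR γ μ (n - 1) * (1 - μ))

/-- Rational function `D_{1,n}(x)`. -/
def D1 (γ μ lam α : ℝ) (i j n : ℕ) (x : ℝ) : ℝ :=
  (x + γ * kdelta i 1) * Dop i (B1 γ μ lam α i j n) x
    + ((n : ℝ) - 1) * B1 γ μ lam α i j n (sh i x)
    + ((n : ℝ) - 1) * ((n : ℝ) + γ - 2) * (x - alphaR γ μ (n - 1)) * μ ^ kdelta i 2 *
        B1 γ μ lam α i j n (sh i x) / (betaR γ μ (n - 1) * (1 - μ))
    + (n : ℝ) * ((n : ℝ) + γ - 1) * μ ^ kdelta i 2 * A1 γ μ lam α i j n (sh i x) / (1 - μ)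

/-- Rational function `C_{2,n}(x)`. -/
def C2 (γ μ lam α : ℝ) (i j n : ℕ) (x : ℝ) : ℝ :=
  -(D1 γ μ lam α i j (n - 1) x) / betaR γ μ (n - 1)

/-- Rational function `D_{2,n}(x)`. -/
def D2 (γ μ lam α : ℝ) (i j n : ℕ) (x : ℝ) : ℝ :=
  C1 γ μ lam α i j (n - 1) x + C2 γ μ lam α i j n x * (alphaR γ μ (n - 1) - x)

/-- `A_{m,n}(x)` for `m = 1, 2`. -/
def Aa (γ μ lam α : ℝ) (i j n m : ℕ) (x : ℝ) : ℝ :=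
  if m = 1 then A1 γ μ lam α i j n x else A2 γ μ lam α i j n x

/-- `B_{m,n}(x)` for `m = 1, 2`. -/
def Bb (γ μ lam α : ℝ) (i j n m : ℕ) (x : ℝ) : ℝ :=
  if m = 1 then B1 γ μ lam α i j n x else B2 γ μ lam α i j n x

/-- `C_{k,n}(x)` for `k = 1, 2`. -/
def Cc (γ μ lam α : ℝ) (i j n k : ℕ) (x : ℝ) : ℝ :=
  if k = 1 then C1 γ μ lam α i j n x else C2 γ μ lam α i j n x

/-- `D_{k,n}(x)` for `k = 1, 2`. -/
def Dd (γ μ lam α : ℝ) (i j n k : ℕ) (x : ℝ) : ℝ :=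
  if k = 1 then D1 γ μ lam α i j n x else D2 γ μ lam α i j n x

/-- `Λ_{m,n}^{(k)}(x) = (−1)^k (C_{k,n}(x) B_{m,n}(x) − A_{m,n}(x) D_{k,n}(x))`. -/
def Lam (γ μ lam α : ℝ) (i j n m k : ℕ) (x : ℝ) : ℝ :=
  (-1 : ℝ) ^ k * (Cc γ μ lam α i j n k x * Bb γ μ lam α i j n m x
    - Aa γ μ lam α i j n m x * Dd γ μ lam α i j n k x)

/-- `Θ_n(x) = A_{1,n}(x) B_{2,n}(x) − B_{1,n}(x) A_{2,n}(x)`. -/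
def Theta (γ μ lam α : ℝ) (i j n : ℕ) (x : ℝ) : ℝ :=
  A1 γ μ lam α i j n x * B2 γ μ lam α i j n x - B1 γ μ lam α i j n x * A2 γ μ lam α i j n x

/-- `Θ̃_n(x) = (x + γ δ_{i,1}) Θ_n(x)`. -/
def Thetatil (γ μ lam α : ℝ) (i j n : ℕ) (x : ℝ) : ℝ :=
  (x + γ * kdelta i 1) * Theta γ μ lam α i j n x

/-! ### Hypergeometric sums behind the Meixner polynomials -/

/-- The truncated sum `∑_{k<K} (−a)_k (−b)_k / ((γ)_k k!) z^k`, symmetric in `a` and `b`. -/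
def hypSum (γ z : ℝ) (K : ℕ) (a b : ℝ) : ℝ :=
  ∑ k ∈ Finset.range K, poch (-a) k * poch (-b) k / poch γ k * z ^ k / (Nat.factorial k : ℝ)

lemma poch_succ (a : ℝ) (k : ℕ) : poch a (k + 1) = poch a k * (a + k) :=
  Finset.prod_range_succ _ _

lemma poch_succ' (a : ℝ) (k : ℕ) : poch a (k + 1) = a * poch (a + 1) k := by
  unfold poch
  rw [Finset.prod_range_succ', mul_comm]
  congr 1
  · simp
  · refine Finset.prod_congr rfl fun m _ => ?_
    push_cast
    ring

lemma fall_succ (a : ℝ) (k : ℕ) : fall a (k + 1) = fall a k * (a - k) :=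
  Finset.prod_range_succ _ _

lemma poch_pos {γ : ℝ} (hγ : 0 < γ) (k : ℕ) : 0 < poch γ k :=
  Finset.prod_pos fun m _ => by positivity

lemma poch_neg_natCast_eq_zero {n k : ℕ} (h : n < k) : poch (-(n : ℝ)) k = 0 :=
  Finset.prod_eq_zero (Finset.mem_range.2 h) (neg_add_cancel _)

lemma mul_poch_sub (a : ℝ) (k : ℕ) :
    a * (poch (-a) k - poch (-(a - 1)) k) = k * poch (-a) k := by
  have h := poch_succ (-a) k
  rw [poch_succ', show -a + 1 = -(a - 1) by ring] at h
  linear_combination h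

lemma mul_hypSum_sub (γ z : ℝ) (K : ℕ) (a b : ℝ) :
    a * (hypSum γ z K a b - hypSum γ z K (a - 1) b) =
      ∑ k ∈ Finset.range K,
        k * (poch (-a) k * poch (-b) k / poch γ k * z ^ k / (Nat.factorial k : ℝ)) := by
  unfold hypSum
  rw [← Finset.sum_sub_distrib, Finset.mul_sum]
  refine Finset.sum_congr rfl fun k _ => ?_
  linear_combination (poch (-b) k / poch γ k * z ^ k / (Nat.factorial k : ℝ)) * mul_poch_sub a k

lemma hypSum_comm (γ z : ℝ) (K : ℕ) (a b : ℝ) : hypSum γ z K a b = hypSum γ z K b a := by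
  unfold hypSum
  refine Finset.sum_congr rfl fun k _ => ?_
  rw [mul_comm (poch (-a) k)]

lemma mul_hypSum_sub_comm (γ z : ℝ) (K : ℕ) (a b : ℝ) :
    a * (hypSum γ z K a b - hypSum γ z K (a - 1) b) =
      b * (hypSum γ z K a b - hypSum γ z K a (b - 1)) := by
  have h := mul_hypSum_sub γ z K b a
  rw [hypSum_comm γ z K b a, hypSum_comm γ z K (b - 1) a] at h
  rw [mul_hypSum_sub, h]
  refine Finset.sum_congr rfl fun k _ => ?_
  rw [mul_comm (poch (-a) k)]

lemma hypSum_forward {γ : ℝ} (hγ : 0 < γ) (z : ℝ) (K : ℕ) (a b : ℝ) :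
    (a + γ) * (hypSum γ z (K + 1) (a + 1) b - hypSum γ z (K + 1) a b) =
      b * z * hypSum γ z (K + 1) a b
        + (1 - z) * (a * (hypSum γ z (K + 1) a b - hypSum γ z (K + 1) (a - 1) b))
        + z * poch (-a) K * poch (-b) (K + 1) / poch γ K * z ^ K / (Nat.factorial K : ℝ) := by
  rw [mul_hypSum_sub]
  induction K with
  | zero => simp [hypSum, poch]; ring
  | succ K ih =>
    rw [Finset.sum_range_succ]
    have e : ∀ a, hypSum γ z (K + 1 + 1) a b = hypSum γ z (K + 1) a b +
        poch (-a) (K + 1) * poch (-b) (K + 1) / poch γ (K + 1) * z ^ (K + 1) /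
          (Nat.factorial (K + 1) : ℝ) := fun a => Finset.sum_range_succ _ _
    rw [e, e]
    have h1 : poch (-(a + 1)) (K + 1) - poch (-a) (K + 1) = -(K + 1) * poch (-a) K := by
      rw [poch_succ', poch_succ, show -(a + 1) + 1 = -a by ring]
      ring
    have hf : ((Nat.factorial (K + 1) : ℕ) : ℝ) = (K + 1) * (Nat.factorial K : ℝ) := by
      push_cast [Nat.factorial_succ]; ring
    have hp := (poch_pos hγ K).ne'
    have hk : (K + 1 : ℝ) ≠ 0 := by positivity
    have hg : γ + K ≠ 0 := by positivity
    have hK : (Nat.factorial K : ℝ) ≠ 0 := by positivity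
    have key : (a + γ) * ((poch (-(a + 1)) (K + 1) - poch (-a) (K + 1)) * poch (-b) (K + 1) /
          poch γ (K + 1) * z ^ (K + 1) / (Nat.factorial (K + 1) : ℝ)) =
        b * z * (poch (-a) (K + 1) * poch (-b) (K + 1) / poch γ (K + 1) * z ^ (K + 1) /
          (Nat.factorial (K + 1) : ℝ))
        + (1 - z) * ((K + 1 : ℕ) * (poch (-a) (K + 1) * poch (-b) (K + 1) / poch γ (K + 1)
          * z ^ (K + 1) / (Nat.factorial (K + 1) : ℝ)))
        + z * poch (-a) (K + 1) * poch (-b) (K + 1 + 1) / poch γ (K + 1) * z ^ (K + 1) /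
          (Nat.factorial (K + 1) : ℝ)
        - z * poch (-a) K * poch (-b) (K + 1) / poch γ K * z ^ K / (Nat.factorial K : ℝ) := by
      rw [h1, hf, poch_succ (-b) (K + 1), poch_succ γ, poch_succ (-a)]
      push_cast
      field_simp
      ring
    linear_combination ih + key

/-! ### Structure relations and three-term recurrence -/

lemma MeixnerM_eq_hypSum (γ μ : ℝ) {n K : ℕ} (h : n < K) (x : ℝ) :
    MeixnerM γ μ n x = poch γ n * (μ / (μ - 1)) ^ n * hypSum γ (1 - μ⁻¹) K n x := by
  unfold MeixnerM hypSum
  congr 1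
  refine Finset.sum_subset (Finset.range_subset_range.2 h) fun k _ hk => ?_
  rw [poch_neg_natCast_eq_zero (by simpa using hk)]
  simp

/-- Forward structure relation `(x + γ) Δ M_{n+1}`. -/
lemma MeixnerM_forward {γ μ : ℝ} (hγ : 0 < γ) (hμ0 : 0 < μ) (hμ1 : μ < 1) (n : ℕ) (x : ℝ) :
    (x + γ) * (MeixnerM γ μ (n + 1) (x + 1) - MeixnerM γ μ (n + 1) x) =
      (n + 1) * MeixnerM γ μ (n + 1) x + (n + 1) * (n + γ) / (1 - μ) * MeixnerM γ μ n x := by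
  have hμ : μ ≠ 0 := hμ0.ne'
  have h1 : μ - 1 ≠ 0 := by linarith
  have h2 : 1 - μ ≠ 0 := by linarith
  have e := hypSum_forward hγ (1 - μ⁻¹) (n + 2) x (n + 1 : ℕ)
  have e' := mul_hypSum_sub_comm γ (1 - μ⁻¹) (n + 2 + 1) x (n + 1 : ℕ)
  rw [poch_neg_natCast_eq_zero (by lia)] at e
  rw [e'] at e
  simp only [MeixnerM_eq_hypSum γ μ (show n + 1 < n + 2 + 1 by lia),
    MeixnerM_eq_hypSum γ μ (show n < n + 2 + 1 by lia)]
  simp only [hypSum_comm γ _ _ x, hypSum_comm γ _ _ (x + 1)] at e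
  push_cast at e ⊢
  rw [add_sub_cancel_right] at e
  rw [poch_succ, pow_succ]
  generalize hypSum γ (1 - μ⁻¹) (n + 2 + 1) (n + 1) (x + 1) = F1 at *
  generalize hypSum γ (1 - μ⁻¹) (n + 2 + 1) (n + 1) x = F2 at *
  generalize hypSum γ (1 - μ⁻¹) (n + 2 + 1) n x = F3 at *
  generalize (μ / (μ - 1)) ^ n = c at *
  have : (n + 1) * (n + γ) / (1 - μ) * (poch γ n * c * F3) =
      (poch γ n * (γ + n) * (c * (μ / (μ - 1)))) * (-(n + 1) / μ * F3) := by
    rw [← neg_sub μ 1]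
    field_simp
    ring
  rw [this]
  have e2 : (x + γ) * (F1 - F2) = (n + 1) * F2 + (-(n + 1) / μ * F3) := by
    rw [e]
    field_simp
    ring
  linear_combination (poch γ n * (γ + n) * (c * (μ / (μ - 1)))) * e2

/-- Backward structure relation `x ∇ M_{n+1}`. -/
lemma MeixnerM_backward {γ μ : ℝ} (hμ1 : μ < 1) (n : ℕ) (x : ℝ) :
    x * (MeixnerM γ μ (n + 1) x - MeixnerM γ μ (n + 1) (x - 1)) =
      (n + 1) * MeixnerM γ μ (n + 1) x + (n + 1) * (n + γ) * μ / (1 - μ) * MeixnerM γ μ n x := by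
  have h1 : μ - 1 ≠ 0 := by linarith
  have h2 : 1 - μ ≠ 0 := by linarith
  have e := mul_hypSum_sub_comm γ (1 - μ⁻¹) (n + 2) x (n + 1 : ℕ)
  simp only [MeixnerM_eq_hypSum γ μ (show n + 1 < n + 2 by lia),
    MeixnerM_eq_hypSum γ μ (show n < n + 2 by lia)]
  simp only [hypSum_comm γ _ _ x, hypSum_comm γ _ _ (x - 1)] at e
  push_cast at e ⊢
  rw [add_sub_cancel_right] at e
  rw [poch_succ, pow_succ]
  generalize hypSum γ (1 - μ⁻¹) (n + 2) (n + 1) (x - 1) = F1 at *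
  generalize hypSum γ (1 - μ⁻¹) (n + 2) (n + 1) x = F2 at *
  generalize hypSum γ (1 - μ⁻¹) (n + 2) n x = F3 at *
  generalize (μ / (μ - 1)) ^ n = c at *
  have : (n + 1) * (n + γ) * μ / (1 - μ) * (poch γ n * c * F3) =
      (poch γ n * (γ + n) * (c * (μ / (μ - 1)))) * (-(n + 1) * F3) := by
    rw [← neg_sub μ 1]
    field_simp
    ring
  rw [this]
  linear_combination (poch γ n * (γ + n) * (c * (μ / (μ - 1)))) * e

lemma MeixnerM_zero (γ μ x : ℝ) : MeixnerM γ μ 0 x = 1 := by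
  simp [MeixnerM, poch]

/-- Second-order difference equation. -/
lemma MeixnerM_difference_equation {γ μ : ℝ} (hγ : 0 < γ) (hμ0 : 0 < μ) (hμ1 : μ < 1)
    (n : ℕ) (x : ℝ) :
    μ * (x + γ) * (MeixnerM γ μ n (x + 1) - MeixnerM γ μ n x)
      - x * (MeixnerM γ μ n x - MeixnerM γ μ n (x - 1)) = -n * (1 - μ) * MeixnerM γ μ n x := by
  cases n with
  | zero => simp [MeixnerM_zero]
  | succ n =>
    push_cast
    linear_combination μ * MeixnerM_forward hγ hμ0 hμ1 n x - MeixnerM_backward hμ1 n x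

/-- Three-term recurrence; at `n = 0` the coefficient `betaR γ μ 0` vanishes. -/
lemma MeixnerM_recurrence {γ μ : ℝ} (hγ : 0 < γ) (hμ0 : 0 < μ) (hμ1 : μ < 1) (n : ℕ) (x : ℝ) :
    x * MeixnerM γ μ n x = MeixnerM γ μ (n + 1) x + alphaR γ μ n * MeixnerM γ μ n x
      + betaR γ μ n * MeixnerM γ μ (n - 1) x := by
  have hμ : μ ≠ 0 := hμ0.ne'
  have h1 : μ - 1 ≠ 0 := by linarith
  have h2 : 1 - μ ≠ 0 := by linarith
  have e := hypSum_forward hγ (1 - μ⁻¹) (n + 1) n x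
  rw [mul_hypSum_sub_comm, poch_neg_natCast_eq_zero (by lia : n < n + 1),
    ← mul_hypSum_sub_comm] at e
  rw [MeixnerM_eq_hypSum γ μ (show n + 1 < n + 1 + 1 by lia),
    MeixnerM_eq_hypSum γ μ (show n < n + 1 + 1 by lia)]
  unfold alphaR betaR
  cases n with
  | zero =>
    simp at e
    have hz : hypSum γ (1 - μ⁻¹) 2 0 x = 1 := by
      simp [hypSum, Finset.sum_range_succ, poch]
    norm_num [hz, poch] at e ⊢
    generalize hypSum γ (1 - μ⁻¹) 2 1 x = F at *
    field_simp at e ⊢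
    linear_combination (μ - 1) * e
  | succ n =>
    rw [add_tsub_cancel_right, MeixnerM_eq_hypSum γ μ (show n < n + 1 + 1 + 1 by lia)]
    push_cast at e ⊢
    rw [add_sub_cancel_right] at e
    rw [poch_succ γ (n + 1), poch_succ γ n, pow_succ _ (n + 1), pow_succ _ n]
    generalize hypSum γ (1 - μ⁻¹) (n + 1 + 1 + 1) (n + 1 + 1) x = F1 at *
    generalize hypSum γ (1 - μ⁻¹) (n + 1 + 1 + 1) (n + 1) x = F2 at *
    generalize hypSum γ (1 - μ⁻¹) (n + 1 + 1 + 1) n x = F3 at *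
    generalize (μ / (μ - 1)) ^ n = c at *
    rw [← neg_sub μ 1]
    push_cast at e ⊢
    simp only [mul_zero, zero_mul, zero_div, add_zero] at e
    field_simp at e ⊢
    linear_combination (-(poch γ n * (γ + n) * c)) * e

/-! ### Meixner polynomials as elements of `ℝ[X]` -/

/-- The monic Meixner polynomials, built from their three-term recurrence. -/
def meixnerPoly (γ μ : ℝ) : ℕ → ℝ[X]
  | 0 => 1
  | 1 => X - C (alphaR γ μ 0)
  | n + 2 => (X - C (alphaR γ μ (n + 1))) * meixnerPoly γ μ (n + 1)
      - C (betaR γ μ (n + 1)) * meixnerPoly γ μ n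

lemma eval_meixnerPoly {γ μ : ℝ} (hγ : 0 < γ) (hμ0 : 0 < μ) (hμ1 : μ < 1) (x : ℝ) :
    ∀ n, (meixnerPoly γ μ n).eval x = MeixnerM γ μ n x
  | 0 => by simp [meixnerPoly, MeixnerM_zero]
  | 1 => by
    have h := MeixnerM_recurrence hγ hμ0 hμ1 0 x
    simp only [MeixnerM_zero, betaR, zero_add, Nat.cast_zero, zero_mul, zero_div] at h
    simp only [meixnerPoly, eval_sub, eval_X, eval_C]
    linear_combination h
  | n + 2 => by
    have h := MeixnerM_recurrence hγ hμ0 hμ1 (n + 1) x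
    rw [add_tsub_cancel_right] at h
    simp only [meixnerPoly, eval_sub, eval_mul, eval_X, eval_C,
      eval_meixnerPoly hγ hμ0 hμ1 x (n + 1), eval_meixnerPoly hγ hμ0 hμ1 x n]
    linear_combination h

lemma meixnerPoly_monic_natDegree (γ μ : ℝ) :
    ∀ n, (meixnerPoly γ μ n).Monic ∧ (meixnerPoly γ μ n).natDegree = n
  | 0 => by simp [meixnerPoly]
  | 1 => by simpa [meixnerPoly] using monic_X_sub_C _
  | n + 2 => by
    obtain ⟨m1, d1⟩ := meixnerPoly_monic_natDegree γ μ (n + 1)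
    obtain ⟨m0, d0⟩ := meixnerPoly_monic_natDegree γ μ n
    have hm := (monic_X_sub_C (alphaR γ μ (n + 1))).mul m1
    have hd : ((X - C (alphaR γ μ (n + 1))) * meixnerPoly γ μ (n + 1)).natDegree = n + 2 := by
      rw [(monic_X_sub_C _).natDegree_mul m1, natDegree_X_sub_C, d1]
      ring
    have hlt : (C (betaR γ μ (n + 1)) * meixnerPoly γ μ n).degree <
        ((X - C (alphaR γ μ (n + 1))) * meixnerPoly γ μ (n + 1)).degree := by
      rw [degree_eq_natDegree hm.ne_zero, hd]
      refine (degree_le_of_natDegree_le (natDegree_C_mul_le _ _)).trans_lt ?_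
      rw [d0]
      exact_mod_cast (by lia : n < n + 2)
    refine ⟨hm.sub_of_left hlt, ?_⟩
    rw [meixnerPoly, natDegree_sub_eq_left_of_natDegree_lt, hd]
    exact (natDegree_C_mul_le _ _).trans_lt (by lia)

lemma exists_eq_sum_meixnerPoly (γ μ : ℝ) (n : ℕ) :
    ∀ p : ℝ[X], p.degree < (n : WithBot ℕ) →
      ∃ c : ℕ → ℝ, p = ∑ k ∈ Finset.range n, C (c k) * meixnerPoly γ μ k := by
  induction n with
  | zero =>
    intro p hp
    refine ⟨0, ?_⟩
    simpa [Nat.WithBot.lt_zero_iff] using hp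
  | succ n ih =>
    intro p hp
    obtain ⟨hm, hd⟩ := meixnerPoly_monic_natDegree γ μ n
    obtain ⟨c, hc⟩ := ih (p - C (p.coeff n) * meixnerPoly γ μ n) (by
      rw [degree_lt_iff_coeff_zero] at hp ⊢
      intro m hnm
      rw [coeff_sub, coeff_C_mul]
      rcases hnm.eq_or_lt with rfl | hlt
      · have := hm.coeff_natDegree
        rw [hd] at this
        rw [this]
        ring
      · rw [hp m hlt, coeff_eq_zero_of_natDegree_lt (p := meixnerPoly γ μ n) (by rwa [hd])]
        ring)
    refine ⟨Function.update c n (p.coeff n), ?_⟩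
    rw [Finset.sum_range_succ, Function.update_self,
      Finset.sum_congr rfl fun k hk => by
        rw [Function.update_of_ne (Finset.mem_range.1 hk).ne], ← hc]
    ring

/-! ### The Meixner functional and orthogonality -/

lemma summable_pow_mul_weight {γ μ : ℝ} (hγ : 0 < γ) (hμ0 : 0 < μ) (hμ1 : μ < 1) (m : ℕ) :
    Summable fun x : ℕ => ((x : ℝ) + 1) ^ m * (μ ^ x * poch γ x / (Nat.factorial x : ℝ)) := by
  have hpos : ∀ x : ℕ, 0 < ((x : ℝ) + 1) ^ m * (μ ^ x * poch γ x / (Nat.factorial x : ℝ)) :=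
    fun x => by have := poch_pos hγ x; positivity
  refine summable_of_ratio_test_tendsto_lt_one hμ1 (.of_forall fun x => (hpos x).ne') ?_
  have key : ∀ x : ℕ, (1 + 1 / ((x : ℝ) + 1)) ^ m * (μ * (1 + (γ - 1) * (1 / ((x : ℝ) + 1)))) =
      ‖((x + 1 : ℕ) + 1 : ℝ) ^ m * (μ ^ (x + 1) * poch γ (x + 1) / (Nat.factorial (x + 1) : ℝ))‖ /
        ‖((x : ℝ) + 1) ^ m * (μ ^ x * poch γ x / (Nat.factorial x : ℝ))‖ := fun x => by
    rw [Real.norm_of_nonneg (hpos x).le, Real.norm_of_nonneg (hpos (x + 1)).le]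
    have := (poch_pos hγ x).ne'
    have hx : (x : ℝ) + 1 ≠ 0 := by positivity
    rw [show 1 + 1 / ((x : ℝ) + 1) = ((x + 1 : ℕ) + 1 : ℝ) / (x + 1) by
      push_cast; field_simp, div_pow, Nat.factorial_succ, poch_succ, pow_succ μ]
    push_cast
    field_simp
    ring
  refine Tendsto.congr key ?_
  have h0 := tendsto_one_div_add_atTop_nhds_zero_nat (𝕜 := ℝ)
  simpa using ((h0.const_add 1).pow m).mul (((h0.const_mul (γ - 1)).const_add 1).const_mul μ)

lemma summable_eval_mul_weight {γ μ : ℝ} (hγ : 0 < γ) (hμ0 : 0 < μ) (hμ1 : μ < 1) (p : ℝ[X]) :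
    Summable fun x : ℕ => p.eval (x : ℝ) * (μ ^ x * poch γ x / (Nat.factorial x : ℝ)) := by
  induction p using Polynomial.induction_on' with
  | add p q hp hq => simpa [add_mul] using hp.add hq
  | monomial m a =>
    simp only [eval_monomial, mul_assoc a]
    refine Summable.mul_left a ?_
    refine (summable_pow_mul_weight hγ hμ0 hμ1 m).of_nonneg_of_le (fun x => ?_) fun x => ?_
    · have := poch_pos hγ x
      positivity
    · have := poch_pos hγ x
      gcongr
      linarith

/-- The moment functional `p ↦ ∑ p(x) μ^x (γ)_x / x!`. -/
def meixnerFunctional {γ μ : ℝ} (hγ : 0 < γ) (hμ0 : 0 < μ) (hμ1 : μ < 1) : ℝ[X] →ₗ[ℝ] ℝ where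
  toFun p := ∑' x : ℕ, p.eval (x : ℝ) * (μ ^ x * poch γ x / (Nat.factorial x : ℝ))
  map_add' p q := by
    rw [← (summable_eval_mul_weight hγ hμ0 hμ1 p).tsum_add
      (summable_eval_mul_weight hγ hμ0 hμ1 q)]
    simp only [eval_add, add_mul]
  map_smul' c p := by
    simp only [eval_smul, smul_eq_mul, mul_assoc, tsum_mul_left, RingHom.id_apply]

lemma mIP_eval {γ μ : ℝ} (hγ : 0 < γ) (hμ0 : 0 < μ) (hμ1 : μ < 1) (p q : ℝ[X]) :
    mIP γ μ (fun x => p.eval x) (fun x => q.eval x) =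
      meixnerFunctional hγ hμ0 hμ1 (p * q) := by
  simp only [mIP, meixnerFunctional, LinearMap.coe_mk, AddHom.coe_mk, eval_mul]
  refine tsum_congr fun x => ?_
  ring

lemma meixnerFunctional_pearson {γ μ : ℝ} (hγ : 0 < γ) (hμ0 : 0 < μ) (hμ1 : μ < 1) (p : ℝ[X]) :
    meixnerFunctional hγ hμ0 hμ1 (X * p) =
      meixnerFunctional hγ hμ0 hμ1 (C μ * ((X + C γ) * p.comp (X + 1))) := by
  have h := (summable_eval_mul_weight hγ hμ0 hμ1 (X * p)).tsum_eq_zero_add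
  simp only [meixnerFunctional, LinearMap.coe_mk, AddHom.coe_mk, h]
  simp only [eval_mul, eval_X, Nat.cast_zero, zero_mul, zero_add]
  refine tsum_congr fun x => ?_
  have hx : (x : ℝ) + 1 ≠ 0 := by positivity
  simp only [eval_comp, eval_add, eval_X, eval_C, eval_one, Nat.factorial_succ, poch_succ, pow_succ]
  push_cast
  field_simp
  ring

/-- The second-order difference operator is symmetric for the Meixner functional. -/
lemma meixnerFunctional_symm {γ μ : ℝ} (hγ : 0 < γ) (hμ0 : 0 < μ) (hμ1 : μ < 1) (p q : ℝ[X]) :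
    meixnerFunctional hγ hμ0 hμ1 (q * (C μ * ((X + C γ) * (p.comp (X + 1) - p))
        - X * (p - p.comp (X - 1)))) =
      -meixnerFunctional hγ hμ0 hμ1
        (C μ * ((X + C γ) * ((p.comp (X + 1) - p) * (q.comp (X + 1) - q)))) := by
  have h := meixnerFunctional_pearson hγ hμ0 hμ1 (q * (p - p.comp (X - 1)))
  have hc : (p.comp (X - 1)).comp (X + 1) = p := by
    rw [comp_assoc]
    simp
  rw [mul_comp, sub_comp, hc] at h
  rw [mul_sub, map_sub, show q * (X * (p - p.comp (X - 1))) = X * (q * (p - p.comp (X - 1))) by ring,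
    h, ← map_sub, ← map_neg]
  congr 1
  ring

lemma meixnerPoly_difference_equation {γ μ : ℝ} (hγ : 0 < γ) (hμ0 : 0 < μ) (hμ1 : μ < 1)
    (n : ℕ) :
    C μ * ((X + C γ) * ((meixnerPoly γ μ n).comp (X + 1) - meixnerPoly γ μ n))
      - X * (meixnerPoly γ μ n - (meixnerPoly γ μ n).comp (X - 1)) =
      (-n * (1 - μ)) • meixnerPoly γ μ n := by
  refine Polynomial.funext fun x => ?_
  simp only [eval_sub, eval_mul, eval_add, eval_comp, eval_X, eval_C, eval_one, eval_smul,
    smul_eq_mul, eval_meixnerPoly hγ hμ0 hμ1]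
  linear_combination MeixnerM_difference_equation hγ hμ0 hμ1 n x

lemma meixnerFunctional_orthogonal {γ μ : ℝ} (hγ : 0 < γ) (hμ0 : 0 < μ) (hμ1 : μ < 1) {m n : ℕ}
    (hmn : m ≠ n) :
    meixnerFunctional hγ hμ0 hμ1 (meixnerPoly γ μ m * meixnerPoly γ μ n) = 0 := by
  have h1 := meixnerFunctional_symm hγ hμ0 hμ1 (meixnerPoly γ μ n) (meixnerPoly γ μ m)
  have h2 := meixnerFunctional_symm hγ hμ0 hμ1 (meixnerPoly γ μ m) (meixnerPoly γ μ n)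
  rw [meixnerPoly_difference_equation hγ hμ0 hμ1, mul_smul_comm, map_smul, smul_eq_mul] at h1 h2
  rw [mul_comm ((meixnerPoly γ μ m).comp (X + 1) - _), ← h1, mul_comm (meixnerPoly γ μ n)] at h2
  have h3 : ((m : ℝ) - n) * (1 - μ) ≠ 0 :=
    mul_ne_zero (sub_ne_zero.2 (Nat.cast_injective.ne hmn)) (by linarith)
  refine (mul_eq_zero.1 ?_).resolve_left h3
  linear_combination -h2

lemma nrm2_eq {γ μ : ℝ} (hγ : 0 < γ) (hμ0 : 0 < μ) (hμ1 : μ < 1) (n : ℕ) :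
    nrm2 γ μ n = meixnerFunctional hγ hμ0 hμ1 (meixnerPoly γ μ n * meixnerPoly γ μ n) := by
  rw [← mIP_eval]
  simp only [eval_meixnerPoly hγ hμ0 hμ1]
  rfl

lemma X_mul_meixnerPoly (γ μ : ℝ) (n : ℕ) :
    X * meixnerPoly γ μ (n + 1) = meixnerPoly γ μ (n + 2)
      + alphaR γ μ (n + 1) • meixnerPoly γ μ (n + 1) + betaR γ μ (n + 1) • meixnerPoly γ μ n := by
  simp only [meixnerPoly, smul_eq_C_mul]
  ring

lemma nrm2_succ {γ μ : ℝ} (hγ : 0 < γ) (hμ0 : 0 < μ) (hμ1 : μ < 1) (n : ℕ) :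
    nrm2 γ μ (n + 1) = betaR γ μ (n + 1) * nrm2 γ μ n := by
  have ho : ∀ {m n}, m ≠ n → meixnerFunctional hγ hμ0 hμ1
      (meixnerPoly γ μ m * meixnerPoly γ μ n) = 0 :=
    fun h => meixnerFunctional_orthogonal hγ hμ0 hμ1 h
  have h1 : meixnerFunctional hγ hμ0 hμ1 (X * meixnerPoly γ μ (n + 1) * meixnerPoly γ μ n) =
      betaR γ μ (n + 1) * nrm2 γ μ n := by
    rw [X_mul_meixnerPoly, nrm2_eq hγ hμ0 hμ1]
    simp [add_mul, ho (show n + 2 ≠ n by lia), ho (show n + 1 ≠ n by lia)]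
  have h2 : meixnerFunctional hγ hμ0 hμ1 (meixnerPoly γ μ (n + 1) * (X * meixnerPoly γ μ n)) =
      nrm2 γ μ (n + 1) := by
    rw [nrm2_eq hγ hμ0 hμ1]
    cases n with
    | zero =>
      have : X * meixnerPoly γ μ 0 =
          meixnerPoly γ μ (0 + 1) + alphaR γ μ 0 • meixnerPoly γ μ 0 := by
        simp [meixnerPoly, smul_eq_C_mul]
      rw [this]
      simp [mul_add, ho (show 1 ≠ 0 by lia)]
    | succ n =>
      rw [X_mul_meixnerPoly]
      simp [mul_add, ho (show n + 1 + 1 ≠ n by lia), ho (show n + 1 + 1 ≠ n + 1 by lia)]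
  rw [← h1, ← h2]
  congr 1
  ring

lemma betaR_succ_pos {γ μ : ℝ} (hγ : 0 < γ) (hμ0 : 0 < μ) (hμ1 : μ < 1) (n : ℕ) :
    0 < betaR γ μ (n + 1) := by
  have : 0 < 1 - μ := by linarith
  have h : ((n + 1 : ℕ) : ℝ) + γ - 1 = n + γ := by push_cast; ring
  rw [betaR, h]
  positivity

lemma nrm2_pos {γ μ : ℝ} (hγ : 0 < γ) (hμ0 : 0 < μ) (hμ1 : μ < 1) (n : ℕ) : 0 < nrm2 γ μ n := by
  induction n with
  | zero =>
    rw [nrm2_eq hγ hμ0 hμ1]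
    have hs := summable_eval_mul_weight hγ hμ0 hμ1 (meixnerPoly γ μ 0 * meixnerPoly γ μ 0)
    refine hs.tsum_pos (fun x => ?_) 0 ?_
    · have := poch_pos hγ x
      simp only [meixnerPoly, mul_one, eval_one]
      positivity
    · simp [meixnerPoly, poch]
  | succ n ih =>
    rw [nrm2_succ hγ hμ0 hμ1]
    exact mul_pos (betaR_succ_pos hγ hμ0 hμ1 n) ih

/-- Christoffel–Darboux formula. -/
lemma sub_mul_kernel {γ μ : ℝ} (hγ : 0 < γ) (hμ0 : 0 < μ) (hμ1 : μ < 1) (n : ℕ) (x y : ℝ) :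
    (x - y) * ∑ k ∈ Finset.range (n + 1), MeixnerM γ μ k x / nrm2 γ μ k * MeixnerM γ μ k y =
      MeixnerM γ μ (n + 1) x / nrm2 γ μ n * MeixnerM γ μ n y
        - MeixnerM γ μ n x / nrm2 γ μ n * MeixnerM γ μ (n + 1) y := by
  induction n with
  | zero =>
    have hx := MeixnerM_recurrence hγ hμ0 hμ1 0 x
    have hy := MeixnerM_recurrence hγ hμ0 hμ1 0 y
    simp only [betaR, Nat.cast_zero, zero_mul, zero_div] at hx hy
    simp only [zero_add, Finset.sum_range_one, MeixnerM_zero] at hx hy ⊢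
    linear_combination (1 / nrm2 γ μ 0) * (hx - hy)
  | succ n ih =>
    rw [Finset.sum_range_succ, mul_add, ih, nrm2_succ hγ hμ0 hμ1]
    have hx := MeixnerM_recurrence hγ hμ0 hμ1 (n + 1) x
    have hy := MeixnerM_recurrence hγ hμ0 hμ1 (n + 1) y
    have hb := (betaR_succ_pos hγ hμ0 hμ1 n).ne'
    have hn := (nrm2_pos hγ hμ0 hμ1 n).ne'
    rw [add_tsub_cancel_right] at hx hy
    field_simp
    linear_combination MeixnerM γ μ (n + 1) y * hx - MeixnerM γ μ (n + 1) x * hy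

/-! ### Difference operators -/

/-- `Dop i` as a linear map. -/
def dopLinear (i : ℕ) : (ℝ → ℝ) →ₗ[ℝ] (ℝ → ℝ) where
  toFun := Dop i
  map_add' f g := by
    ext x
    simp only [Dop, Pi.add_apply]
    split_ifs <;> ring
  map_smul' c f := by
    ext x
    simp only [Dop, Pi.smul_apply, smul_eq_mul, RingHom.id_apply]
    split_ifs <;> ring

lemma Dk_eq (i k : ℕ) (f : ℝ → ℝ) : Dk i k f = (dopLinear i ^ k) f := by
  rw [Module.End.pow_apply]
  rfl

lemma Dk_succ (i k : ℕ) (f : ℝ → ℝ) : Dk i (k + 1) f = Dop i (Dk i k f) :=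
  Function.iterate_succ_apply' _ _ _

lemma Dk_sub (i k : ℕ) (f g : ℝ → ℝ) : Dk i k (f - g) = Dk i k f - Dk i k g := by
  simp only [Dk_eq, map_sub]

lemma Dk_smul (i k : ℕ) (c : ℝ) (f : ℝ → ℝ) : Dk i k (c • f) = c • Dk i k f := by
  simp only [Dk_eq, map_smul]

lemma Dk_sum (i k : ℕ) {ι : Type*} (s : Finset ι) (f : ι → ℝ → ℝ) :
    Dk i k (∑ m ∈ s, f m) = ∑ m ∈ s, Dk i k (f m) := by
  simp only [Dk_eq, map_sum]

/-- The sign of the step of `𝒟_i`. -/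
def stepSign (i : ℕ) : ℝ := if i = 1 then 1 else -1

lemma br_succ (i : ℕ) (x : ℝ) (k : ℕ) : br i x (k + 1) = br i x k * (x - stepSign i * k) := by
  unfold br stepSign
  split_ifs
  · rw [fall_succ, one_mul]
  · rw [poch_succ]
    ring

lemma Dk_succ_sub_mul (i k : ℕ) (x : ℝ) (g : ℝ → ℝ) (a : ℝ) :
    Dk i (k + 1) (fun y => (x - y) * g y) a =
      (x - a - stepSign i * (k + 1)) * Dk i (k + 1) g a - (k + 1) * Dk i k g a := by
  induction k generalizing a with
  | zero =>
    simp only [Dk, Function.iterate_succ, Function.comp, Function.iterate_zero, id, Dop, stepSign]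
    split_ifs <;> push_cast <;> ring
  | succ k ih =>
    rw [Dk_succ, _root_.funext ih]
    have e : Dk i (k + 1) g a = Dop i (Dk i k g) a := by rw [Dk_succ]
    rw [Dk_succ i (k + 1), e]
    simp only [Dop, stepSign] at e ⊢
    split_ifs at e ⊢
    · push_cast
      linear_combination -e
    · push_cast
      linear_combination -e

/-- Discrete Leibniz rule for `𝒟_i^j` applied to `h(y) / (x - y)`. -/
lemma sum_br_mul_Dk_sub_mul (i j : ℕ) (x a : ℝ) (g : ℝ → ℝ) :
    ∑ k ∈ Finset.range (j + 1),
        br i (x - a) k / (Nat.factorial k : ℝ) * Dk i k (fun y => (x - y) * g y) a =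
      br i (x - a) (j + 1) / (Nat.factorial j : ℝ) * Dk i j g a := by
  induction j with
  | zero => simp [br, Dk, fall, poch]
  | succ j ih =>
    rw [Finset.sum_range_succ, ih, Dk_succ_sub_mul, br_succ i _ (j + 1), Nat.factorial_succ]
    have hj : (j : ℝ) + 1 ≠ 0 := by positivity
    push_cast
    field_simp
    ring

/-! ### Connection formula for the Sobolev polynomials -/

lemma Klm_diag_nonneg {γ μ : ℝ} (hγ : 0 < γ) (hμ0 : 0 < μ) (hμ1 : μ < 1) (i j n : ℕ) (α : ℝ) :
    0 ≤ Klm γ μ i j j n α α :=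
  Finset.sum_nonneg fun k _ => div_nonneg (mul_self_nonneg _) (nrm2_pos hγ hμ0 hμ1 k).le

lemma IsSobolevOP.eq_sub_kernel {γ μ lam α : ℝ} (hγ : 0 < γ) (hμ0 : 0 < μ) (hμ1 : μ < 1)
    {i j n : ℕ} {Q : ℝ[X]} (hQ : IsSobolevOP γ μ lam α i j n Q) :
    (fun x => Q.eval x) = MeixnerM γ μ n - ∑ k ∈ Finset.range n,
      (lam * Dk i j (fun x => Q.eval x) α * Dk i j (MeixnerM γ μ k) α / nrm2 γ μ k) •
        MeixnerM γ μ k := by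
  obtain ⟨hQm, hQd, hQo⟩ := hQ
  obtain ⟨hm, hd⟩ := meixnerPoly_monic_natDegree γ μ n
  have hlt : (Q - meixnerPoly γ μ n).degree < (n : WithBot ℕ) := by
    have hdeg : Q.degree = n := by rw [degree_eq_natDegree hQm.ne_zero, hQd]
    rw [← hdeg]
    refine degree_sub_lt_left ?_ hQm.ne_zero ?_
    · rw [hdeg, degree_eq_natDegree hm.ne_zero, hd]
    · rw [hQm.leadingCoeff, hm.leadingCoeff]
  obtain ⟨c, hc⟩ := exists_eq_sum_meixnerPoly γ μ n _ hlt
  have hck : ∀ k ∈ Finset.range n,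
      c k = -(lam * Dk i j (fun x => Q.eval x) α * Dk i j (MeixnerM γ μ k) α / nrm2 γ μ k) := by
    intro k hk
    have hkn := Finset.mem_range.1 hk
    obtain ⟨hmk, hdk⟩ := meixnerPoly_monic_natDegree γ μ k
    have h := hQo (meixnerPoly γ μ k) (by
      rw [degree_eq_natDegree hmk.ne_zero, hdk]
      exact_mod_cast hkn)
    rw [sIP, mIP_eval hγ hμ0 hμ1, sub_eq_iff_eq_add.1 hc, add_mul, map_add,
      meixnerFunctional_orthogonal hγ hμ0 hμ1 hkn.ne', Finset.sum_mul, map_sum,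
      Finset.sum_eq_single_of_mem k hk, ← smul_eq_C_mul, smul_mul_assoc, map_smul,
      ← nrm2_eq hγ hμ0 hμ1, ← hc, sub_add_cancel] at h
    · simp only [eval_meixnerPoly hγ hμ0 hμ1] at h
      have hn := (nrm2_pos hγ hμ0 hμ1 k).ne'
      field_simp
      rw [smul_eq_mul] at h
      linear_combination h
    · intro l _ hlk
      rw [← smul_eq_C_mul, smul_mul_assoc, map_smul,
        meixnerFunctional_orthogonal hγ hμ0 hμ1 hlk, smul_zero]
  ext x
  have hx := congrArg (eval x) hc
  simp only [eval_sub, eval_finsetSum, eval_mul, eval_C, eval_meixnerPoly hγ hμ0 hμ1] at hx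
  rw [Finset.sum_congr rfl fun k hk => by rw [hck k hk]] at hx
  simp only [Pi.sub_apply, Finset.sum_apply, Pi.smul_apply, smul_eq_mul]
  simp only [neg_mul, Finset.sum_neg_distrib] at hx
  linear_combination hx

lemma IsSobolevOP.Dk_eval {γ μ lam α : ℝ} (hγ : 0 < γ) (hμ0 : 0 < μ) (hμ1 : μ < 1)
    {i j n : ℕ} {Q : ℝ[X]} (hQ : IsSobolevOP γ μ lam α i j (n + 1) Q) :
    Dk i j (fun x => Q.eval x) α * (1 + lam * Klm γ μ i j j n α α) =
      Dk i j (MeixnerM γ μ (n + 1)) α := by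
  have h := congrFun (congrArg (Dk i j) (hQ.eq_sub_kernel hγ hμ0 hμ1)) α
  rw [Dk_sub, Dk_sum] at h
  simp only [Dk_smul, Pi.sub_apply, Finset.sum_apply, Pi.smul_apply, smul_eq_mul] at h
  generalize Dk i j (fun x => Q.eval x) α = d at *
  have e : d * (lam * Klm γ μ i j j n α α) = ∑ k ∈ Finset.range (n + 1),
      lam * d * Dk i j (MeixnerM γ μ k) α / nrm2 γ μ k * Dk i j (MeixnerM γ μ k) α := by
    rw [Klm, Finset.mul_sum, Finset.mul_sum]
    refine Finset.sum_congr rfl fun k _ => ?_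
    ring
  linear_combination h + e

/-- Christoffel–Darboux formula for the kernel differenced in its second variable. -/
lemma br_mul_Dk_kernel {γ μ : ℝ} (hγ : 0 < γ) (hμ0 : 0 < μ) (hμ1 : μ < 1) (i j n : ℕ)
    (x α : ℝ) :
    br i (x - α) (j + 1) / (Nat.factorial j : ℝ) * ∑ k ∈ Finset.range (n + 1),
        MeixnerM γ μ k x / nrm2 γ μ k * Dk i j (MeixnerM γ μ k) α =
      ∑ k ∈ Finset.range (j + 1), br i (x - α) k / (Nat.factorial k : ℝ) *
        (MeixnerM γ μ (n + 1) x / nrm2 γ μ n * Dk i k (MeixnerM γ μ n) α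
          - MeixnerM γ μ n x / nrm2 γ μ n * Dk i k (MeixnerM γ μ (n + 1)) α) := by
  set g : ℝ → ℝ := ∑ k ∈ Finset.range (n + 1), (MeixnerM γ μ k x / nrm2 γ μ k) • MeixnerM γ μ k
    with hg
  have hD : Dk i j g α = ∑ k ∈ Finset.range (n + 1),
      MeixnerM γ μ k x / nrm2 γ μ k * Dk i j (MeixnerM γ μ k) α := by
    rw [hg, Dk_sum]
    simp only [Dk_smul, Finset.sum_apply, Pi.smul_apply, smul_eq_mul]
  have hcd : (fun y => (x - y) * g y) = (MeixnerM γ μ (n + 1) x / nrm2 γ μ n) • MeixnerM γ μ n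
      - (MeixnerM γ μ n x / nrm2 γ μ n) • MeixnerM γ μ (n + 1) := by
    ext y
    simp only [hg, Finset.sum_apply, Pi.smul_apply, Pi.sub_apply, smul_eq_mul]
    exact sub_mul_kernel hγ hμ0 hμ1 n x y
  rw [← hD, ← sum_br_mul_Dk_sub_mul, hcd]
  simp only [Dk_sub, Dk_smul, Pi.sub_apply, Pi.smul_apply, smul_eq_mul]

/-- Connection formula `Q_{n+1} = A_{1,n+1} M_{n+1} + B_{1,n+1} M_n`. -/
lemma IsSobolevOP.eval_eq {γ μ lam α : ℝ} (hγ : 0 < γ) (hμ0 : 0 < μ) (hμ1 : μ < 1)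
    (hlam : 0 < lam) {i j n : ℕ} {Q : ℝ[X]} (hQ : IsSobolevOP γ μ lam α i j (n + 1) Q) {x : ℝ}
    (hbr : br i (x - α) (j + 1) ≠ 0) :
    Q.eval x = A1 γ μ lam α i j (n + 1) x * MeixnerM γ μ (n + 1) x
      + B1 γ μ lam α i j (n + 1) x * MeixnerM γ μ n x := by
  have hq := congrFun (hQ.eq_sub_kernel hγ hμ0 hμ1) x
  have hd := hQ.Dk_eval hγ hμ0 hμ1
  simp only [Finset.sum_apply, Pi.smul_apply, Pi.sub_apply, smul_eq_mul] at hq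
  generalize Dk i j (fun x => Q.eval x) α = d at *
  have hK : 1 + lam * Klm γ μ i j j n α α ≠ 0 := by
    have := Klm_diag_nonneg hγ hμ0 hμ1 i j n α
    positivity
  have hn := (nrm2_pos hγ hμ0 hμ1 n).ne'
  have hj : (Nat.factorial j : ℝ) ≠ 0 := by positivity
  have hker := br_mul_Dk_kernel hγ hμ0 hμ1 i j n x α
  have hS : ∑ k ∈ Finset.range (n + 1), lam * d * Dk i j (MeixnerM γ μ k) α / nrm2 γ μ k *
      MeixnerM γ μ k x = lam * d * ∑ k ∈ Finset.range (n + 1),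
        MeixnerM γ μ k x / nrm2 γ μ k * Dk i j (MeixnerM γ μ k) α := by
    rw [Finset.mul_sum]
    refine Finset.sum_congr rfl fun k _ => ?_
    ring
  have hAB : (∑ k ∈ Finset.range (j + 1), acoef γ μ lam α i j (n + 1) k * br i (x - α) k) *
        MeixnerM γ μ (n + 1) x
      + (∑ k ∈ Finset.range (j + 1), bcoef γ μ lam α i j (n + 1) k * br i (x - α) k) *
        MeixnerM γ μ n x =
      -(lam * d * (Nat.factorial j : ℝ)) * ∑ k ∈ Finset.range (j + 1),
        br i (x - α) k / (Nat.factorial k : ℝ) *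
        (MeixnerM γ μ (n + 1) x / nrm2 γ μ n * Dk i k (MeixnerM γ μ n) α
          - MeixnerM γ μ n x / nrm2 γ μ n * Dk i k (MeixnerM γ μ (n + 1)) α) := by
    rw [Finset.sum_mul, Finset.sum_mul, Finset.mul_sum, ← Finset.sum_add_distrib]
    refine Finset.sum_congr rfl fun k _ => ?_
    have hk : (Nat.factorial k : ℝ) ≠ 0 := by positivity
    rw [acoef, bcoef, add_tsub_cancel_right, ← hd]
    field_simp
    ring
  rw [hS] at hq
  rw [← hker] at hAB
  rw [hq, A1, B1]
  field_simp at hAB ⊢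
  linear_combination -hAB

/-- Both structure relations for `M_{n+1}` in one formula. -/
lemma MeixnerM_structure {γ μ : ℝ} (hγ : 0 < γ) (hμ0 : 0 < μ) (hμ1 : μ < 1) {i : ℕ}
    (hi : i = 1 ∨ i = 2) (n : ℕ) (x : ℝ) :
    (x + γ * kdelta i 1) * Dop i (MeixnerM γ μ (n + 1)) x =
      (n + 1) * MeixnerM γ μ (n + 1) x
        + (n + 1) * (n + γ) * μ ^ kdelta i 2 / (1 - μ) * MeixnerM γ μ n x := by
  rcases hi with rfl | rfl
  · simpa [Dop, kdelta] using MeixnerM_forward hγ hμ0 hμ1 n x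
  · simpa [Dop, kdelta] using MeixnerM_backward (γ := γ) hμ1 n x

/-- Product rule for `𝒟_i`. -/
lemma Dop_mul {i : ℕ} (hi : i = 1 ∨ i = 2) (f g : ℝ → ℝ) (x : ℝ) :
    Dop i (fun t => f t * g t) x = Dop i f x * g x + f (sh i x) * Dop i g x := by
  rcases hi with rfl | rfl <;> simp [Dop, sh] <;> ring

lemma Dop_congr {i : ℕ} (hi : i = 1 ∨ i = 2) {f g : ℝ → ℝ} {x : ℝ} (h : f x = g x)
    (h' : f (sh i x) = g (sh i x)) : Dop i f x = Dop i g x := by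
  rcases hi with rfl | rfl <;> simp_all [Dop, sh]

/-- Structure relation `(x + γδ_{i,1}) 𝒟_i Q_{n+1} = C_{1,n+1} M_{n+1} + D_{1,n+1} M_n`. -/
lemma IsSobolevOP.structure_relation {γ μ lam α : ℝ} (hγ : 0 < γ) (hμ0 : 0 < μ) (hμ1 : μ < 1)
    (hlam : 0 < lam) {i j n : ℕ} (hi : i = 1 ∨ i = 2) {Q : ℝ[X]}
    (hQ : IsSobolevOP γ μ lam α i j (n + 1) Q) {x : ℝ}
    (hbr : br i (x - α) (j + 1) ≠ 0) (hbr' : br i (sh i x - α) (j + 1) ≠ 0) :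
    (x + γ * kdelta i 1) * Dop i (fun t => Q.eval t) x =
      C1 γ μ lam α i j (n + 1) x * MeixnerM γ μ (n + 1) x
        + D1 γ μ lam α i j (n + 1) x * MeixnerM γ μ n x := by
  have hadd : ∀ f g : ℝ → ℝ, Dop i (fun t => f t + g t) x = Dop i f x + Dop i g x :=
    fun f g => congrFun ((dopLinear i).map_add f g) x
  rw [Dop_congr hi (g := fun t =>
      A1 γ μ lam α i j (n + 1) t * MeixnerM γ μ (n + 1) t
      + B1 γ μ lam α i j (n + 1) t * MeixnerM γ μ n t)
      (hQ.eval_eq hγ hμ0 hμ1 hlam hbr) (hQ.eval_eq hγ hμ0 hμ1 hlam hbr'), hadd, Dop_mul hi, Dop_mul hi, C1, D1, add_tsub_cancel_right]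
  have hs := MeixnerM_structure hγ hμ0 hμ1 hi n x
  cases n with
  | zero =>
    have h0 : Dop i (MeixnerM γ μ 0) x = 0 := by
      simp [Dop, MeixnerM_zero]
    rw [h0]
    simp only [MeixnerM_zero, Nat.cast_zero, zero_add, Nat.cast_one, sub_self, zero_mul,
      zero_div] at hs ⊢
    linear_combination A1 γ μ lam α i j 1 (sh i x) * hs
  | succ n =>
    have hs' := MeixnerM_structure hγ hμ0 hμ1 hi n x
    have hr := MeixnerM_recurrence hγ hμ0 hμ1 (n + 1) x
    have hb := (betaR_succ_pos hγ hμ0 hμ1 n).ne'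
    rw [add_tsub_cancel_right] at hr
    have hM : MeixnerM γ μ n x = ((x - alphaR γ μ (n + 1)) * MeixnerM γ μ (n + 1) x
        - MeixnerM γ μ (n + 1 + 1) x) / betaR γ μ (n + 1) := by
      rw [eq_div_iff hb]
      linear_combination -hr
    rw [hM] at hs'
    push_cast at hs hs' ⊢
    simp only [div_eq_mul_inv, mul_inv] at hs hs' ⊢
    linear_combination A1 γ μ lam α i j (n + 1 + 1) (sh i x) * hs
      + B1 γ μ lam α i j (n + 1 + 1) (sh i x) * hs'

/-- `(x + γδ_{i,1}) 𝒟_i Q_{n−1}^{(i)}(x) = C_{2,n}(x) M_n(x) + D_{2,n}(x) M_{n−1}(x)`. -/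
theorem sobolev_structure_relation_nsub (γ μ lam α : ℝ) (hγ : 0 < γ) (hμ0 : 0 < μ)
    (hμ1 : μ < 1) (hlam : 0 < lam) (hα : α ≤ 0) (j i n : ℕ) (hi : i = 1 ∨ i = 2)
    (hn : 2 ≤ n) (Q : Polynomial ℝ) (hQ : IsSobolevOP γ μ lam α i j (n - 1) Q) (x : ℝ)
    (hbr : br i (x - α) (j + 1) ≠ 0) (hbr' : br i (sh i x - α) (j + 1) ≠ 0) :
    (x + γ * kdelta i 1) * Dop i (fun t => Q.eval t) x =
      C2 γ μ lam α i j n x * MeixnerM γ μ n x +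
        D2 γ μ lam α i j n x * MeixnerM γ μ (n - 1) x := by
  obtain ⟨n, rfl⟩ := Nat.exists_eq_add_of_le' hn
  rw [show n + 2 - 1 = n + 1 by lia] at hQ ⊢
  rw [hQ.structure_relation hγ hμ0 hμ1 hlam hi hbr hbr', D2, C2, show n + 2 - 1 = n + 1 by lia]
  have hr := MeixnerM_recurrence hγ hμ0 hμ1 (n + 1) x
  have hb := (betaR_succ_pos hγ hμ0 hμ1 n).ne'
  rw [add_tsub_cancel_right] at hr
  field_simp
  linear_combination -D1 γ μ lam α i j (n + 1) x * hr
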